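/- Let T be a homogeneous tree with branching number b_T, 0 < ε ≤ 1, L an infinite subset of ℕ, and for every n ∈ L let D_n be a subset of T(n) with dens(D_n) ≥ ε. Then there exist an infinite subset N of L and, for every k ∈ N, a node t_k ∈ D_k such that for all k, n ∈ N with k < n and every p ∈ {0,…,b_T−1}, dens(D_n | t_k⌢_T p) ≥ ε²/(8 b_T⁴). -/

import Mathlib

open Filter

namespace DHLPaper

/-- The tree `b^{<ℕ}` of all finite sequences with values in `{0,…,b−1}`,
partially ordered by end-extension (`List.IsPrefix`, written `<+:`). -/
def bSeq (b : ℕ) : Set (List ℕ) := {t | ∀ x ∈ t, x < b}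

/-- The set of successors of `t` in `T`: `Suc_T(t) = {s ∈ T : t ≤ s}`. -/
def suc (T : Set (List ℕ)) (t : List ℕ) : Set (List ℕ) := {s ∈ T | t <+: s}

/-- `s` is an immediate successor of `t` in `T`. -/
def ImmSuc (T : Set (List ℕ)) (t s : List ℕ) : Prop :=
  t ∈ T ∧ s ∈ T ∧ t <+: s ∧ t ≠ s ∧ ∀ u ∈ T, t <+: u → u <+: s → u = t ∨ u = s

/-- The `n`-th level of `T`: the nodes of `T` with exactly `n` strict predecessors in `T`. -/
def level (T : Set (List ℕ)) (n : ℕ) : Set (List ℕ) :=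
  {t ∈ T | {s ∈ T | s <+: t ∧ s ≠ t}.ncard = n}

/-- `T` has exactly one minimal node. -/
def UniquelyRooted (T : Set (List ℕ)) : Prop := ∃! r, r ∈ level T 0

/-- Every node of `T` has finitely many immediate successors in `T`. -/
def FinitelyBranching (T : Set (List ℕ)) : Prop := ∀ t ∈ T, {s | ImmSuc T t s}.Finite

/-- Every node of `T` has at least one immediate successor in `T`. -/
def Pruned (T : Set (List ℕ)) : Prop := ∀ t ∈ T, ∃ s, ImmSuc T t s

/-- `S` is a strong subtree of `T` whose level set `L_T(S)` is enumerated by the strictly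
increasing map `l`: `S(n) ⊆ T(l n)` for every `n`, `S` is uniquely rooted, and for every
`s ∈ S` and every immediate successor `t` of `s` in `T` there is a unique immediate
successor `s'` of `s` in `S` with `t ≤ s'`. -/
def IsStrongSubtreeWith (T S : Set (List ℕ)) (l : ℕ → ℕ) : Prop :=
  S ⊆ T ∧ UniquelyRooted S ∧ StrictMono l ∧
    (∀ n, level S n ⊆ level T (l n)) ∧
    (∀ s ∈ S, ∀ t, ImmSuc T s t → ∃! s', ImmSuc S s s' ∧ t <+: s')

/-- `S` is a strong subtree of `T`. -/
def IsStrongSubtree (T S : Set (List ℕ)) : Prop := ∃ l, IsStrongSubtreeWith T S l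

/-- A homogeneous tree with branching number `b`: a strong subtree of `b^{<ℕ}`, `b ≥ 2`. -/
def IsHomogeneous (b : ℕ) (T : Set (List ℕ)) : Prop := 2 ≤ b ∧ IsStrongSubtree (bSeq b) T

/-- A vector homogeneous tree: a `d`-tuple of homogeneous trees. -/
def IsVecHomogeneous {d : ℕ} (b : Fin d → ℕ) (T : Fin d → Set (List ℕ)) : Prop :=
  ∀ i, IsHomogeneous (b i) (T i)

/-- Vector strong subtree: componentwise strong subtrees with a common level set. -/
def IsVecStrongSubtree {d : ℕ} (T S : Fin d → Set (List ℕ)) : Prop :=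
  ∃ l, ∀ i, IsStrongSubtreeWith (T i) (S i) l

/-- `⊗T(n) = T_1(n) × ⋯ × T_d(n)`. -/
def vecLevel {d : ℕ} (T : Fin d → Set (List ℕ)) (n : ℕ) : Set (Fin d → List ℕ) :=
  {v | ∀ i, v i ∈ level (T i) n}

/-- The level product `⊗T = ⋃_n ⊗T(n)`. -/
def levelProd {d : ℕ} (T : Fin d → Set (List ℕ)) : Set (Fin d → List ℕ) :=
  ⋃ n, vecLevel T n

/-- `r` is the root tuple of the vector tree `T`. -/
def IsRoot {d : ℕ} (T : Fin d → Set (List ℕ)) (r : Fin d → List ℕ) : Prop :=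
  ∀ i, level (T i) 0 = {r i}

/-- `F` is a vector fan of `T`: `F = (R_1(0) ∪ R_1(1), …, R_d(0) ∪ R_d(1))` for some
vector strong subtree `R` of `T`. -/
def IsVecFan {d : ℕ} (T F : Fin d → Set (List ℕ)) : Prop :=
  ∃ R : Fin d → Set (List ℕ), IsVecStrongSubtree T R ∧
    ∀ i, F i = level (R i) 0 ∪ level (R i) 1

/-- `fan(T,n)`: the vector fans of `T` with `⊗F(1) ⊆ ⊗T(n)`. -/
def fanAt {d : ℕ} (T : Fin d → Set (List ℕ)) (n : ℕ) : Set (Fin d → Set (List ℕ)) :=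
  {F | IsVecFan T F ∧ vecLevel F 1 ⊆ vecLevel T n}

/-- Density of `F ⊆ W(n)` in the `n`-th level of `W`. -/
noncomputable def dens (W : Set (List ℕ)) (n : ℕ) (F : Set (List ℕ)) : ℝ :=
  (F.ncard : ℝ) / ((level W n).ncard : ℝ)

/-- Density of `F ⊆ W(n)` relative to the node `w`. -/
noncomputable def densRel (W : Set (List ℕ)) (n : ℕ) (F : Set (List ℕ)) (w : List ℕ) : ℝ :=
  ((F ∩ suc W w).ncard : ℝ) / ((level W n ∩ suc W w).ncard : ℝ)

/-- `s = w ⌢_W p`: `s` is the immediate successor of `w` in `W` such that the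
concatenation `w ⌢ p` is an initial segment of `s`. -/
def IsConcat (W : Set (List ℕ)) (w : List ℕ) (p : ℕ) (s : List ℕ) : Prop :=
  ImmSuc W w s ∧ w ++ [p] <+: s

/-- The density Halpern–Läuchli statement in dimension `d`. -/
def DHL (d : ℕ) : Prop :=
  ∀ (b : Fin d → ℕ) (T : Fin d → Set (List ℕ)), IsVecHomogeneous b T →
    ∀ D : Set (Fin d → List ℕ), D ⊆ levelProd T →
      0 < Filter.limsup
          (fun n => ((D ∩ vecLevel T n).ncard : ℝ) / ((vecLevel T n).ncard : ℝ)) atTop →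
      ∃ S : Fin d → Set (List ℕ), IsVecStrongSubtree T S ∧ levelProd S ⊆ D

/-- `D : ⊗T → 2^W` is an `ε`-dense level selection along the strictly increasing
sequence `l`: for every `n` and every `t⃗ ∈ ⊗T(n)`, `D(t⃗) ⊆ W(l n)` and
`dens(D(t⃗)) ≥ ε`. -/
def IsDenseLevelSel {d : ℕ} (T : Fin d → Set (List ℕ)) (W : Set (List ℕ)) (l : ℕ → ℕ)
    (ε : ℝ) (D : (Fin d → List ℕ) → Set (List ℕ)) : Prop :=
  StrictMono l ∧ ∀ n, ∀ v ∈ vecLevel T n, D v ⊆ level W (l n) ∧ ε ≤ dens W (l n) (D v)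

/-- The pair `(R, w)` (`R` a vector strong subtree of `T` with root tuple `r0`) is strongly
`θ`-correlated with respect to the dense level selection `D` (with level sequence `l`):
`w ∈ D(r0)` and for every vector fan `F` of `R` with `F(0) = r0` and every `p < b_W`,
`dens(⋂_{r ∈ ⊗F(1)} D(r) | w ⌢_W p) ≥ θ`. -/
def StronglyCorrelated {d : ℕ} (T : Fin d → Set (List ℕ)) (W : Set (List ℕ)) (bW : ℕ)
    (l : ℕ → ℕ) (D : (Fin d → List ℕ) → Set (List ℕ)) (R : Fin d → Set (List ℕ))
    (r0 : Fin d → List ℕ) (w : List ℕ) (θ : ℝ) : Prop :=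
  w ∈ D r0 ∧
    ∀ F : Fin d → Set (List ℕ), IsVecFan R F → IsRoot F r0 →
      ∀ n, vecLevel F 1 ⊆ vecLevel T n →
        ∀ p < bW, ∀ s, IsConcat W w p s →
          θ ≤ densRel W (l n) (⋂ r ∈ vecLevel F 1, D r) s

/-- The average of `F` over the `b ^ k` extensions of `w` by `k` further letters, where a
sequence is extended by consing. -/
noncomputable def avg {b : ℕ} : ℕ → (List (Fin b) → ℝ) → List (Fin b) → ℝ
  | 0, F, w => F w
  | k + 1, F, w => (∑ p, avg k F (p :: w)) / b

section Avg

variable {b : ℕ}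

lemma avg_mono {k : ℕ} {F G : List (Fin b) → ℝ} {w : List (Fin b)}
    (h : ∀ u, u.length = w.length + k → F u ≤ G u) : avg k F w ≤ avg k G w := by
  induction k generalizing w with
  | zero => exact h w rfl
  | succ k ih =>
    simp only [avg]
    gcongr with p
    exact ih fun u hu => h u (by simp only [List.length_cons] at hu; omega)

lemma avg_const (hb : b ≠ 0) (k : ℕ) (c : ℝ) (w : List (Fin b)) :
    avg k (fun _ => c) w = c := by
  induction k generalizing w with
  | zero => rfl
  | succ k ih => simp [avg, ih, hb]

lemma avg_add (k : ℕ) (F G : List (Fin b) → ℝ) (w : List (Fin b)) :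
    avg k (fun u => F u + G u) w = avg k F w + avg k G w := by
  induction k generalizing w with
  | zero => rfl
  | succ k ih => simp only [avg, ih, Finset.sum_add_distrib, add_div]

lemma avg_const_mul (k : ℕ) (c : ℝ) (F : List (Fin b) → ℝ) (w : List (Fin b)) :
    avg k (fun u => c * F u) w = c * avg k F w := by
  induction k generalizing w with
  | zero => rfl
  | succ k ih => simp only [avg, ih, ← Finset.mul_sum, mul_div_assoc]

lemma avg_comp (m j : ℕ) (F : List (Fin b) → ℝ) (w : List (Fin b)) :
    avg m (avg j F) w = avg (m + j) F w := by
  induction m generalizing w with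
  | zero => simp [avg]
  | succ m ih => simp only [Nat.succ_add, avg, ih]

/-- A function on the tree whose value at each node is the mean of its values at the children. -/
def IsHarmonic (f : List (Fin b) → ℝ) : Prop := ∀ w, avg 1 f w = f w

lemma IsHarmonic.avg_eq {f : List (Fin b) → ℝ} (hf : IsHarmonic f) (k : ℕ) (w : List (Fin b)) :
    avg k f w = f w := by
  induction k with
  | zero => rfl
  | succ k ih =>
    rw [← avg_comp, show avg 1 f = f from funext hf, ih]

lemma IsHarmonic.avg_sq_sub {f : List (Fin b) → ℝ} (hf : IsHarmonic f) (hb : b ≠ 0) (k : ℕ)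
    (w : List (Fin b)) :
    avg k (fun u => (f u - f w) ^ 2) w = avg k (fun u => f u ^ 2) w - f w ^ 2 := by
  have h : (fun u => (f u - f w) ^ 2) =
      fun u => f u ^ 2 + ((-2 * f w) * f u + f w ^ 2) := by
    funext u; ring
  rw [h, avg_add, avg_add, avg_const_mul, hf.avg_eq, avg_const hb]
  ring

/-- If every node of length `m + j` where `F` does not vanish has a child at which the harmonic
function `f` is at most `η`, then the mean of `F` is controlled by the part of `F` living over
`{f ≤ 2 * η}` and by the energy increment of `f`. -/
lemma IsHarmonic.avg_le_of_small_child {f F : List (Fin b) → ℝ} (hf : IsHarmonic f)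
    (hb : b ≠ 0) {η c : ℝ} (hη : 0 < η) (m j : ℕ) (hF1 : ∀ u, F u ≤ 1)
    (hc : ∀ w, w.length = m → avg j F w ≤ f w + c) (hc0 : 0 ≤ c)
    (hbad : ∀ u, u.length = m + j → F u ≠ 0 → ∃ p, f (p :: u) ≤ η) :
    avg (m + j) F [] ≤ 2 * η + c + b / η ^ 2 *
      (avg (m + (j + 1)) (fun u => f u ^ 2) [] - avg m (fun u => f u ^ 2) []) := by
  have hb0 : (0 : ℝ) < b := by positivity
  have key : ∀ w : List (Fin b), w.length = m → avg j F w ≤ (2 * η + c) + b / η ^ 2 *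
      (avg (j + 1) (fun u => f u ^ 2) w + (-1) * f w ^ 2) := by
    intro w hw
    have hK : 0 ≤ b / η ^ 2 := by positivity
    have hE : avg (j + 1) (fun u => f u ^ 2) w + (-1) * f w ^ 2 =
        avg j (avg 1 fun u => (f u - f w) ^ 2) w := by
      rw [avg_comp, hf.avg_sq_sub hb]; ring
    rw [hE]
    have hpos : ∀ u, 0 ≤ avg 1 (fun u => (f u - f w) ^ 2) u := fun u => by
      simp only [avg]; positivity
    by_cases hfw : f w ≤ 2 * η
    · have h1 : avg j F w ≤ 2 * η + c := by linarith [hc w hw]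
      have h2 : 0 ≤ avg j (avg 1 fun u => (f u - f w) ^ 2) w := by
        rw [← avg_const hb j 0 w]
        exact avg_mono fun u _ => hpos u
      linarith [mul_nonneg hK h2]
    · push Not at hfw
      have h1 : avg j F w ≤ b / η ^ 2 * avg j (avg 1 fun u => (f u - f w) ^ 2) w := by
        rw [← avg_const_mul]
        refine avg_mono fun u hu => ?_
        by_cases hFu : F u = 0
        · rw [hFu]; exact mul_nonneg hK (hpos u)
        obtain ⟨p, hp⟩ := hbad u (by omega) hFu
        have h2 : η ^ 2 ≤ ∑ q, (f (q :: u) - f w) ^ 2 := by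
          refine le_trans ?_ (Finset.single_le_sum (f := fun q => (f (q :: u) - f w) ^ 2)
            (fun q _ => sq_nonneg _) (Finset.mem_univ p))
          nlinarith
        refine (hF1 u).trans ?_
        simp only [avg]
        rw [div_mul_div_comm, mul_comm, mul_div_mul_right _ _ hb0.ne', one_le_div (by positivity)]
        exact h2
      linarith
  rw [← avg_comp]
  refine (avg_mono (w := []) fun w hw => key w (by simpa using hw)).trans (le_of_eq ?_)
  rw [avg_add, avg_const hb, avg_const_mul, avg_add, avg_const_mul, avg_comp]
  ring

lemma exists_energy_almost_max {f : List (Fin b) → ℝ} (hb : b ≠ 0) (hf0 : ∀ w, 0 ≤ f w)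
    (hf1 : ∀ w, f w ≤ 1) {γ : ℝ} (hγ : 0 < γ) :
    ∃ m, ∀ k, avg k (fun u => f u ^ 2) [] < avg m (fun u => f u ^ 2) [] + γ := by
  set M : ℕ → ℝ := fun k => avg k (fun u => f u ^ 2) []
  have hbdd : BddAbove (Set.range M) := by
    refine ⟨1, ?_⟩
    rintro _ ⟨k, rfl⟩
    rw [← avg_const hb k 1 []]
    exact avg_mono fun u _ => pow_le_one₀ (hf0 u) (hf1 u)
  obtain ⟨m, hm⟩ := exists_lt_of_lt_ciSup (show iSup M - γ < iSup M by linarith)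
  exact ⟨m, fun k => by linarith [le_ciSup hbdd k]⟩

/-- Dense sets `F n` of nodes of length `n` admit a limiting density `f` along an ultrafilter,
which is harmonic. -/
lemma exists_limit_density (hb : b ≠ 0) (F : ℕ → List (Fin b) → ℝ)
    (hF0 : ∀ n u, 0 ≤ F n u) (hF1 : ∀ n u, F n u ≤ 1) (U : Ultrafilter ℕ)
    (hU : (U : Filter ℕ) ≤ atTop) :
    ∃ f : List (Fin b) → ℝ, IsHarmonic f ∧ (∀ w, 0 ≤ f w) ∧ (∀ w, f w ≤ 1) ∧
      ∀ w, Tendsto (fun n => avg (n - w.length) (F n) w) U (nhds (f w)) := by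
  have hmem : ∀ n k w, avg k (F n) w ∈ Set.Icc (0 : ℝ) 1 := fun n k w =>
    ⟨by rw [← avg_const hb k 0 w]; exact avg_mono fun u _ => hF0 n u,
      by rw [← avg_const hb k 1 w]; exact avg_mono fun u _ => hF1 n u⟩
  have hlim : ∀ w : List (Fin b), ∃ x ∈ Set.Icc (0 : ℝ) 1,
      Tendsto (fun n => avg (n - w.length) (F n) w) U (nhds x) := fun w =>
    isCompact_Icc.ultrafilter_le_nhds (U.map fun n => avg (n - w.length) (F n) w)
      (le_principal_iff.2 (Filter.mem_map.2 (Filter.univ_mem' fun n => hmem n _ w)))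
  choose f hf hft using hlim
  refine ⟨f, fun w => ?_, fun w => (hf w).1, fun w => (hf w).2, hft⟩
  have h : Tendsto (fun n => (∑ p, avg (n - (p :: w).length) (F n) (p :: w)) / (b : ℝ)) U
      (nhds (avg 1 f w)) := (tendsto_finsetSum _ fun p _ => hft (p :: w)).div_const _
  refine tendsto_nhds_unique (h.congr' ?_) (hft w)
  filter_upwards [hU (eventually_gt_atTop w.length)] with n hn
  obtain ⟨k, rfl⟩ := Nat.exists_eq_add_of_lt hn
  simp only [List.length_cons, show w.length + k + 1 - (w.length + 1) = k by omega,
    show w.length + k + 1 - w.length = k + 1 by omega, avg]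

/-- Sequences of dense subsets of the levels of the full `b`-ary tree are correlated along an
infinite set of levels. -/
theorem exists_correlated_nodes (hb : b ≠ 0) {ε δ : ℝ} (hε : 0 < ε) (hδ : δ < ε / 8)
    {L : Set ℕ} (hL : L.Infinite) (F : ℕ → List (Fin b) → ℝ)
    (hF0 : ∀ n u, 0 ≤ F n u) (hF1 : ∀ n u, F n u ≤ 1) (hF : ∀ n ∈ L, ε ≤ avg n (F n) []) :
    ∃ N ⊆ L, N.Infinite ∧ ∃ v : ℕ → List (Fin b),
      (∀ k ∈ N, (v k).length = k ∧ F k (v k) ≠ 0) ∧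
      ∀ k ∈ N, ∀ n ∈ N, k < n → ∀ p, δ ≤ avg (n - (k + 1)) (F n) (p :: v k) := by
  have hne : (atTop ⊓ 𝓟 L).NeBot :=
    frequently_mem_iff_neBot.1 (Nat.frequently_atTop_iff_infinite.2 hL)
  set U : Ultrafilter ℕ := Ultrafilter.of (atTop ⊓ 𝓟 L)
  have hUle : (U : Filter ℕ) ≤ atTop ⊓ 𝓟 L := Ultrafilter.of_le _
  have hUtop : (U : Filter ℕ) ≤ atTop := hUle.trans inf_le_left
  have hUL : ∀ᶠ n in (U : Filter ℕ), n ∈ L := le_principal_iff.1 (hUle.trans inf_le_right)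
  obtain ⟨f, hf, hf0, hf1, hft⟩ := exists_limit_density hb F hF0 hF1 U hUtop
  set η : ℝ := ε / 8 with hη
  have hη0 : 0 < η := by positivity
  have hb0 : (0 : ℝ) < b := by positivity
  have hgood : ∀ᶠ k in (U : Filter ℕ),
      ∃ u : List (Fin b), u.length = k ∧ F k u ≠ 0 ∧ ∀ p, η < f (p :: u) := by
    obtain ⟨m, hm⟩ := exists_energy_almost_max hb hf0 hf1 (γ := η ^ 3 / b) (by positivity)
    have hclose : ∀ᶠ k in (U : Filter ℕ), ∀ w ∈ {w : List (Fin b) | w.length = m},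
        avg (k - w.length) (F k) w ≤ f w + η :=
      (List.finite_length_eq (Fin b) m).eventually_all.2 fun w _ =>
        (hft w).eventually_le_const (by linarith)
    filter_upwards [hclose, hUL, hUtop (eventually_ge_atTop m)] with k hk hkL hkm
    obtain ⟨j, rfl⟩ := Nat.exists_eq_add_of_le hkm
    by_contra! hcon
    have h := hf.avg_le_of_small_child (F := F (m + j)) hb hη0 m j (hF1 _) (c := η)
      (fun w hw => by simpa [hw] using hk w hw) hη0.le hcon
    have h1 := hm (m + (j + 1))
    have h2 : b / η ^ 2 * (avg (m + (j + 1)) (fun u => f u ^ 2) [] -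
        avg m (fun u => f u ^ 2) []) ≤ b / η ^ 2 * (η ^ 3 / b) := by
      gcongr; linarith
    have h3 : b / η ^ 2 * (η ^ 3 / b) = η := by field_simp
    linarith [hF _ hkL]
  choose! v hv using fun (k : ℕ) (h : ∃ u : List (Fin b), u.length = k ∧ F k u ≠ 0 ∧
    ∀ p, η < f (p :: u)) => h
  set P : ℕ → Prop := fun k => k ∈ L ∧ (v k).length = k ∧ F k (v k) ≠ 0 ∧
    ∀ p, η < f (p :: v k)
  have hPU : ∀ᶠ k in (U : Filter ℕ), P k := by
    filter_upwards [hgood, hUL] with k hk hkL using ⟨hkL, hv k hk⟩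
  obtain ⟨φ, hφP, hφ⟩ := exists_seq_of_forall_finset_exists P
    (fun k n => k < n ∧ ∀ p, δ ≤ avg (n - (k + 1)) (F n) (p :: v k)) (by
      intro s hs
      refine Eventually.exists (f := (U : Filter ℕ)) (hPU.and ?_)
      refine s.eventually_all.2 fun k hk =>
        ((eventually_gt_atTop k).filter_mono hUtop).and ?_
      refine eventually_all.2 fun p => ?_
      obtain ⟨-, hlen, -, hpos⟩ := hs k hk
      have h := (hft (p :: v k)).eventually_const_le (hδ.trans (hpos p))
      simpa [hlen] using h)
  have hmono : StrictMono φ := fun i j hij => (hφ i j hij).1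
  refine ⟨Set.range φ, ?_, Set.infinite_range_of_injective hmono.injective, v, ?_, ?_⟩
  · rintro _ ⟨i, rfl⟩
    exact (hφP i).1
  · rintro _ ⟨i, rfl⟩
    exact ⟨(hφP i).2.1, (hφP i).2.2.1⟩
  · rintro _ ⟨i, rfl⟩ _ ⟨j, rfl⟩ hij
    exact (hφ i j (hmono.lt_iff_lt.1 hij)).2

end Avg

section Trees

variable {T : Set (List ℕ)} {b : ℕ}

/-- The set of strict predecessors of `t` in `T`. -/
def strictPred (T : Set (List ℕ)) (t : List ℕ) : Set (List ℕ) := {s ∈ T | s <+: t ∧ s ≠ t}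

lemma finite_strictPred (T : Set (List ℕ)) (t : List ℕ) : (strictPred T t).Finite :=
  t.inits.finite_toSet.subset fun _ hs => (List.mem_inits _ _).2 hs.2.1

lemma strictPred_of_immSuc {t s : List ℕ} (h : ImmSuc T t s) :
    strictPred T s = insert t (strictPred T t) := by
  obtain ⟨ht, hs, hts, hne, himm⟩ := h
  ext u
  simp only [strictPred, Set.mem_insert_iff, Set.mem_ofPred_eq]
  constructor
  · rintro ⟨hu, hus, hne'⟩
    rcases List.prefix_or_prefix_of_prefix hus hts with h | h
    · by_cases hut : u = t
      · exact Or.inl hut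
      · exact Or.inr ⟨hu, h, hut⟩
    · exact Or.inl ((himm u hu h hus).resolve_right hne')
  · rintro (rfl | ⟨hu, hut, hne'⟩)
    · exact ⟨ht, hts, hne⟩
    · refine ⟨hu, hut.trans hts, ?_⟩
      rintro rfl
      exact hne' (hut.eq_of_length (le_antisymm hut.length_le hts.length_le))

lemma level_succ_of_immSuc {t s : List ℕ} {n : ℕ} (h : ImmSuc T t s) (ht : t ∈ level T n) :
    s ∈ level T (n + 1) := by
  refine ⟨h.2.1, ?_⟩
  change (strictPred T s).ncard = n + 1
  rw [strictPred_of_immSuc h, Set.ncard_insert_of_notMem (fun h => h.2.2 rfl)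
    (finite_strictPred T t)]
  exact congrArg (· + 1) ht.2

lemma eq_of_prefix_of_level {t s : List ℕ} {n : ℕ} (ht : t ∈ level T n) (hs : s ∈ level T n)
    (hts : t <+: s) : s = t := by
  by_contra hne
  have hlt : (strictPred T t).ncard < (strictPred T s).ncard := by
    refine Set.ncard_lt_ncard (Set.ssubset_iff_exists.2 ⟨?_, t, ?_, ?_⟩) (finite_strictPred T s)
    · rintro u ⟨hu, hut, hne'⟩
      refine ⟨hu, hut.trans hts, ?_⟩
      rintro rfl
      exact hne' (hut.eq_of_length (le_antisymm hut.length_le hts.length_le))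
    · exact ⟨ht.1, hts, fun h => hne h.symm⟩
    · exact fun h => h.2.2 rfl
  have h1 : (strictPred T t).ncard = n := ht.2
  have h2 : (strictPred T s).ncard = n := hs.2
  omega

lemma exists_immSuc_le {t u : List ℕ} (ht : t ∈ T) (hu : u ∈ T) (htu : t <+: u)
    (hne : t ≠ u) : ∃ s, ImmSuc T t s ∧ s <+: u := by
  obtain ⟨s, ⟨hsT, hts, hne', hsu⟩, hmin⟩ := exists_minimalFor_of_wellFoundedLT
    (fun s => s ∈ T ∧ t <+: s ∧ t ≠ s ∧ s <+: u) List.length ⟨u, hu, htu, hne, List.prefix_rfl⟩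
  refine ⟨s, ⟨ht, hsT, hts, hne', fun v hv htv hvs => ?_⟩, hsu⟩
  by_cases hvt : v = t
  · exact Or.inl hvt
  · exact Or.inr (hvs.eq_of_length (le_antisymm hvs.length_le
      (hmin ⟨hv, htv, fun h => hvt h.symm, hvs.trans hsu⟩ hvs.length_le)))

lemma exists_root_le {u : List ℕ} (hu : u ∈ T) : ∃ r ∈ level T 0, r <+: u := by
  obtain ⟨r, ⟨hrT, hru⟩, hmin⟩ := exists_minimalFor_of_wellFoundedLT
    (fun s => s ∈ T ∧ s <+: u) List.length ⟨u, hu, List.prefix_rfl⟩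
  refine ⟨r, ⟨hrT, (Set.ncard_eq_zero (finite_strictPred T r)).2 ?_⟩, hru⟩
  refine Set.eq_empty_of_forall_notMem fun s hs => hs.2.2 (hs.2.1.eq_of_length ?_)
  exact le_antisymm hs.2.1.length_le (hmin ⟨hs.1, hs.2.1.trans hru⟩ hs.2.1.length_le)

lemma immSuc_bSeq {t : List ℕ} (ht : t ∈ bSeq b) {p : ℕ} (hp : p < b) :
    ImmSuc (bSeq b) t (t ++ [p]) := by
  refine ⟨ht, ?_, List.prefix_append _ _, by simp, fun u _ htu hu => ?_⟩
  · intro x hx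
    rcases List.mem_append.1 hx with hx | hx
    · exact ht x hx
    · rwa [List.mem_singleton.1 hx]
  · rcases List.prefix_concat_iff.1 hu with h | h
    · exact Or.inr h
    · exact Or.inl (h.eq_of_length (le_antisymm h.length_le htu.length_le))

lemma IsHomogeneous.existsUnique_concat (hT : IsHomogeneous b T) {t : List ℕ} (ht : t ∈ T)
    {p : ℕ} (hp : p < b) : ∃! s, IsConcat T t p s := by
  obtain ⟨-, l, hsub, -, -, -, h⟩ := hT
  exact h t ht _ (immSuc_bSeq (hsub ht) hp)

/-- `e` identifies the finite sequences in `Fin b`, extended by consing, with the nodes of the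
tree `T`. -/
structure IsCoding (b : ℕ) (T : Set (List ℕ)) (e : List (Fin b) → List ℕ) : Prop where
  root_mem : e [] ∈ level T 0
  concat : ∀ (w : List (Fin b)) (p : Fin b), IsConcat T (e w) p (e (p :: w))

lemma IsHomogeneous.exists_isCoding (hT : IsHomogeneous b T) : ∃ e, IsCoding b T e := by
  have hex : ∀ t ∈ T, ∀ p : Fin b, ∃ s, IsConcat T t p s := fun t ht p =>
    (hT.existsUnique_concat ht p.2).exists
  choose! g hg using hex
  obtain ⟨r, hr, -⟩ : UniquelyRooted T := by
    obtain ⟨-, l, -, h, -⟩ := hT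
    exact h
  have hmem : ∀ w : List (Fin b), w.foldr (fun p t => g t p) r ∈ T := by
    intro w
    induction w with
    | nil => exact hr.1
    | cons p w ih => exact (hg _ ih p).1.2.1
  exact ⟨fun w => w.foldr (fun p t => g t p) r, hr, fun w p => hg _ (hmem w) p⟩

namespace IsCoding

variable {e : List (Fin b) → List ℕ}

lemma mem_level (he : IsCoding b T e) (w : List (Fin b)) : e w ∈ level T w.length := by
  induction w with
  | nil => exact he.root_mem
  | cons p w ih => exact level_succ_of_immSuc (he.concat w p).1 ih

lemma suc_root (he : IsCoding b T e) (hT : IsHomogeneous b T) : suc T (e []) = T := by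
  refine Set.Subset.antisymm (fun u hu => hu.1) fun u hu => ⟨hu, ?_⟩
  obtain ⟨-, l, -, ⟨r, -, hr⟩, -⟩ := hT
  obtain ⟨r', hr', hpre⟩ := exists_root_le hu
  rwa [hr _ he.root_mem, ← hr _ hr']

lemma exists_mem_suc_child (he : IsCoding b T e) (hT : IsHomogeneous b T) {w : List (Fin b)}
    {u : List ℕ} (hu : u ∈ suc T (e w)) (hne : e w ≠ u) : ∃ p, u ∈ suc T (e (p :: w)) := by
  obtain ⟨s, hs, hsu⟩ := exists_immSuc_le (he.mem_level w).1 hu.1 hu.2 hne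
  obtain ⟨x, rfl⟩ := hs.2.2.1
  obtain _ | ⟨p, x⟩ := x
  · exact absurd (List.append_nil _).symm hs.2.2.2.1
  have hp : p < b := hT.2.choose_spec.1 hs.2.1 p (by simp)
  have hcat : IsConcat T (e w) p (e w ++ p :: x) := ⟨hs, ⟨x, by simp⟩⟩
  exact ⟨⟨p, hp⟩, hu.1,
    (hT.existsUnique_concat (he.mem_level w).1 hp).unique (he.concat w ⟨p, hp⟩) hcat ▸ hsu⟩

lemma disjoint_suc (he : IsCoding b T e) (w : List (Fin b)) {p q : Fin b} (hpq : p ≠ q) :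
    Disjoint (suc T (e (p :: w))) (suc T (e (q :: w))) := by
  refine Set.disjoint_left.2 fun u hu hu' => hpq (Fin.ext ?_)
  have h := (List.prefix_of_prefix_length_le ((he.concat w p).2.trans hu.2)
    ((he.concat w q).2.trans hu'.2) (by simp)).eq_of_length (by simp)
  simpa using h

lemma inter_suc_finite_and_ncard (he : IsCoding b T e) (hT : IsHomogeneous b T)
    (k : ℕ) (w : List (Fin b)) {A : Set (List ℕ)} (hA : A ⊆ level T (w.length + k)) :
    (A ∩ suc T (e w)).Finite ∧ ((A ∩ suc T (e w)).ncard : ℝ) =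
      (b : ℝ) ^ k * avg k ((e ⁻¹' A).indicator 1) w := by
  have hb : (b : ℝ) ≠ 0 := by have := hT.1; positivity
  induction k generalizing w with
  | zero =>
    by_cases hw : e w ∈ A
    · have h : A ∩ suc T (e w) = {e w} := by
        refine Set.Subset.antisymm (fun u hu => ?_) ?_
        · exact eq_of_prefix_of_level (he.mem_level w) (hA hu.1) hu.2.2
        · rintro _ rfl
          exact ⟨hw, (he.mem_level w).1, List.prefix_rfl⟩
      simp [h, avg, hw]
    · have h : A ∩ suc T (e w) = ∅ := by
        refine Set.eq_empty_of_forall_notMem fun u hu => hw ?_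
        rw [← eq_of_prefix_of_level (he.mem_level w) (hA hu.1) hu.2.2]
        exact hu.1
      simp [h, avg, hw]
  | succ k ih =>
    have hA' : ∀ p : Fin b, A ⊆ level T ((p :: w).length + k) := fun p => by
      rwa [List.length_cons, Nat.add_right_comm, Nat.add_assoc]
    have h : A ∩ suc T (e w) = ⋃ p, A ∩ suc T (e (p :: w)) := by
      ext u
      simp only [Set.mem_iUnion, Set.mem_inter_iff]
      constructor
      · rintro ⟨huA, hu⟩
        obtain ⟨p, hp⟩ := he.exists_mem_suc_child hT hu (by
          rintro rfl
          have h1 := (hA huA).2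
          have h2 := (he.mem_level w).2
          omega)
        exact ⟨p, huA, hp⟩
      · rintro ⟨p, huA, hu⟩
        exact ⟨huA, hu.1, (he.concat w p).1.2.2.1.trans hu.2⟩
    refine ⟨h ▸ Set.finite_iUnion fun p => (ih (p :: w) (hA' p)).1, ?_⟩
    rw [h, Set.ncard_iUnion_of_finite (fun p => (ih (p :: w) (hA' p)).1) fun p q hpq =>
      (he.disjoint_suc w hpq).mono Set.inter_subset_right Set.inter_subset_right,
      finsum_eq_sum_of_fintype]
    push_cast
    rw [Finset.sum_congr rfl fun p _ => (ih (p :: w) (hA' p)).2, ← Finset.mul_sum]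
    simp only [avg]
    field_simp
    ring

lemma densRel_eq_avg (he : IsCoding b T e) (hT : IsHomogeneous b T) (k : ℕ) (w : List (Fin b))
    {A : Set (List ℕ)} (hA : A ⊆ level T (w.length + k)) :
    densRel T (w.length + k) A (e w) = avg k ((e ⁻¹' A).indicator 1) w := by
  have hb : b ≠ 0 := by have := hT.1; omega
  have hone : avg k ((e ⁻¹' level T (w.length + k)).indicator 1) w = 1 := by
    rw [← avg_const hb k 1 w]
    have hmem : ∀ u : List (Fin b), u.length = w.length + k →
        (e ⁻¹' level T (w.length + k)).indicator (1 : List (Fin b) → ℝ) u = 1 := fun u hu =>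
      Set.indicator_of_mem (s := e ⁻¹' _) (hu ▸ he.mem_level u) _
    exact le_antisymm (avg_mono fun u hu => (hmem u hu).le) (avg_mono fun u hu => (hmem u hu).ge)
  rw [densRel, (he.inter_suc_finite_and_ncard hT k w hA).2,
    (he.inter_suc_finite_and_ncard hT k w subset_rfl).2, hone, mul_one]
  field_simp

lemma dens_eq_avg (he : IsCoding b T e) (hT : IsHomogeneous b T) {n : ℕ} {A : Set (List ℕ)}
    (hA : A ⊆ level T n) : dens T n A = avg n ((e ⁻¹' A).indicator 1) [] := by
  have hlev : level T n ⊆ T := fun u hu => hu.1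
  have h := he.densRel_eq_avg hT n [] (A := A) (by simpa using hA)
  rw [← h, densRel, he.suc_root hT]
  simp only [List.length_nil, zero_add, Set.inter_eq_left.2 hlev,
    Set.inter_eq_left.2 (hA.trans hlev), dens]

end IsCoding

end Trees

/-- Corollary A.3. -/
theorem one_dim_correlation_corollary (bT : ℕ) (T : Set (List ℕ))
    (hT : IsHomogeneous bT T)
    (ε : ℝ) (hε0 : 0 < ε) (hε1 : ε ≤ 1)
    (L : Set ℕ) (hL : L.Infinite) (D : ℕ → Set (List ℕ))
    (hD : ∀ n ∈ L, D n ⊆ level T n ∧ ε ≤ dens T n (D n)) :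
    ∃ N ⊆ L, N.Infinite ∧ ∃ t : ℕ → List ℕ, (∀ k ∈ N, t k ∈ D k) ∧
      ∀ k ∈ N, ∀ n ∈ N, k < n → ∀ p < bT, ∀ s, IsConcat T (t k) p s →
        ε ^ 2 / (8 * (bT : ℝ) ^ 4) ≤ densRel T n (D n) s := by
  obtain ⟨e, he⟩ := hT.exists_isCoding
  have hb : (2 : ℝ) ≤ bT := by exact_mod_cast hT.1
  have hδ : ε ^ 2 / (8 * (bT : ℝ) ^ 4) < ε / 8 := by
    have h1 : (1 : ℝ) < (bT : ℝ) ^ 4 := one_lt_pow₀ (by linarith) (by norm_num)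
    rw [div_lt_div_iff₀ (by positivity) (by norm_num)]
    nlinarith [mul_lt_mul_of_pos_left h1 hε0]
  obtain ⟨N, hNL, hN, v, hv, hcor⟩ := exists_correlated_nodes (b := bT)
    (by have := hT.1; omega) hε0 hδ hL (fun n => (e ⁻¹' D n).indicator 1)
    (fun n u => Set.indicator_nonneg (fun _ _ => zero_le_one) u)
    (fun n u => Set.indicator_le_self' (fun _ _ => zero_le_one) u)
    (fun n hn => by rw [← he.dens_eq_avg hT (hD n hn).1]; exact (hD n hn).2)
  refine ⟨N, hNL, hN, fun k => e (v k),
    fun k hk => Set.mem_of_indicator_ne_zero (s := e ⁻¹' D k) (hv k hk).2, fun k hk n hn hkn p hp s hs => ?_⟩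
  have hlen : ((⟨p, hp⟩ : Fin bT) :: v k).length + (n - (k + 1)) = n := by
    rw [List.length_cons, (hv k hk).1]; omega
  have hse : s = e (⟨p, hp⟩ :: v k) :=
    (hT.existsUnique_concat (he.mem_level _).1 hp).unique hs (he.concat _ ⟨p, hp⟩)
  have h := he.densRel_eq_avg hT (n - (k + 1)) (⟨p, hp⟩ :: v k) (A := D n)
    (by rw [hlen]; exact (hD n (hNL hn)).1)
  rw [hlen] at h
  rw [hse, h]
  exact hcor k hk n hn hkn ⟨p, hp⟩
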